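/- (Optimality.) Let d ≥ 2, let η be the uniform distribution on d outcomes, and let p, q ∈ ℝ^d be probability distributions with D(p‖η) > 0, D(q‖η) > 0, V(p‖η) > 0 and V(q‖η) > 0. Let (t_n) be a moderate sequence, set ε_n^− = e^{−n t_n²} and ε_n^+ = 1 − e^{−n t_n²}, define R_n^{th}(ε) = (1/n)·sup{ m ∈ ℕ : p^{⊗n} ⊗ η^{⊗m} ≻_ε q^{⊗m} ⊗ η^{⊗n} } (approximate majorisation with total variation error), and set ν = (V(p‖η)/D(p‖η)) / (V(q‖η)/D(q‖η)). Then, for both choices of sign, limsup_{n→∞} ( R_n^{th}(ε_n^±) − D(p‖η)/D(q‖η) ) / t_n ≤ ±(√(2 V(p‖η)) / D(q‖η)) · |1 ± 1/√ν|. -/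

import Mathlib

open Finset Filter Real Topology

noncomputable section

/-- A probability distribution on a finite type: nonnegative entries summing to 1. -/
def IsProbDist {α : Type*} [Fintype α] (a : α → ℝ) : Prop :=
  (∀ i, 0 ≤ a i) ∧ ∑ i, a i = 1

/-- A sharp distribution: a single entry equal to 1, all others 0. -/
def IsSharp {α : Type*} [Fintype α] (a : α → ℝ) : Prop :=
  ∃ i, a i = 1 ∧ ∀ j, j ≠ i → a j = 0

/-- The uniform distribution: all entries equal to `1 / |α|`. -/
def IsUniform {α : Type*} [Fintype α] (a : α → ℝ) : Prop :=
  ∀ i, a i = 1 / (Fintype.card α : ℝ)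

/-- Tensor (Kronecker) product of two vectors. -/
def tensor {α β : Type*} (a : α → ℝ) (b : β → ℝ) : α × β → ℝ :=
  fun x => a x.1 * b x.2

/-- `n`-fold tensor power of a vector. -/
def tpow {α : Type*} (a : α → ℝ) (n : ℕ) : (Fin n → α) → ℝ :=
  fun f => ∏ j, a (f j)

/-- Shannon entropy (natural logarithm, with the convention `0 · ln 0 = 0`). -/
def shannonH {α : Type*} [Fintype α] (a : α → ℝ) : ℝ :=
  -∑ i, a i * Real.log (a i)

/-- Entropy variance `V(a) = ∑ i, a i (ln a i + H(a))²`. -/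
def entV {α : Type*} [Fintype α] (a : α → ℝ) : ℝ :=
  ∑ i, a i * (Real.log (a i) + shannonH a) ^ 2

/-- Relative entropy `D(a‖b)`. -/
def relD {α : Type*} [Fintype α] (a b : α → ℝ) : ℝ :=
  ∑ i, a i * Real.log (a i / b i)

/-- Relative entropy variance `V(a‖b)`. -/
def relV {α : Type*} [Fintype α] (a b : α → ℝ) : ℝ :=
  ∑ i, a i * (Real.log (a i / b i) - relD a b) ^ 2

/-- Total variation distance. -/
def tvd {α : Type*} [Fintype α] (a b : α → ℝ) : ℝ :=
  (1 / 2) * ∑ i, |a i - b i|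

/-- Fidelity `F(a,b) = (∑ i √(a i · b i))²`. -/
def fid {α : Type*} [Fintype α] (a b : α → ℝ) : ℝ :=
  (∑ i, Real.sqrt (a i * b i)) ^ 2

/-- The entries of `a` sorted in non-increasing order, as a vector on `Fin (card α)`. -/
def descSorted {α : Type*} [Fintype α] (a : α → ℝ) : Fin (Fintype.card α) → ℝ :=
  fun i =>
    a ((Fintype.equivFin α).symm
      (Tuple.sort (fun j => -a ((Fintype.equivFin α).symm j)) i))

/-- `headSum a K = ∑_{1 ≤ i ≤ K} a^↓_i` (1-based indices `i`, comparison `(i : ℝ) ≤ K`,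
equivalently `i ≤ ⌊K⌋`). -/
def headSum {α : Type*} [Fintype α] (a : α → ℝ) (K : ℝ) : ℝ :=
  ∑ i ∈ Finset.univ.filter (fun i : Fin (Fintype.card α) => ((i : ℕ) + 1 : ℝ) ≤ K),
    descSorted a i

/-- `tailSum a K = ∑_{i ≥ K} a^↓_i` (1-based indices `i`, comparison `K ≤ (i : ℝ)`,
equivalently `i ≥ ⌈K⌉`). -/
def tailSum {α : Type*} [Fintype α] (a : α → ℝ) (K : ℝ) : ℝ :=
  ∑ i ∈ Finset.univ.filter (fun i : Fin (Fintype.card α) => K ≤ ((i : ℕ) + 1 : ℝ)),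
    descSorted a i

/-- `a` majorises `b` (written `a ≻ b`): every partial sum of the non-increasingly sorted
`a` dominates the corresponding partial sum of sorted `b` (shorter vectors padded with zeros). -/
def Maj {α β : Type*} [Fintype α] [Fintype β] (a : α → ℝ) (b : β → ℝ) : Prop :=
  ∀ j : ℕ, headSum b (j : ℝ) ≤ headSum a (j : ℝ)

/-- `a ≻_ε b`: approximate majorisation (from above) with total variation error:
there is a probability distribution `b̃` with `a ≻ b̃` and `δ(b, b̃) ≤ ε`. -/
def ApproxMajTV {α β : Type*} [Fintype α] [Fintype β] (a : α → ℝ) (b : β → ℝ) (ε : ℝ) : Prop :=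
  ∃ bt : β → ℝ, IsProbDist bt ∧ Maj a bt ∧ tvd b bt ≤ ε

/-- `a ≺_ε b`: approximate majorisation (from below) with total variation error:
there is a probability distribution `b̃` with `a ≺ b̃` and `δ(b, b̃) ≤ ε`. -/
def ApproxSubMajTV {α β : Type*} [Fintype α] [Fintype β] (a : α → ℝ) (b : β → ℝ) (ε : ℝ) : Prop :=
  ∃ bt : β → ℝ, IsProbDist bt ∧ Maj bt a ∧ tvd b bt ≤ ε

/-- A moderate sequence: `t n → 0` and `√n · t n → +∞`. -/
def ModerateSeq (t : ℕ → ℝ) : Prop :=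
  Tendsto t atTop (𝓝 0) ∧ Tendsto (fun n : ℕ => Real.sqrt (n : ℝ) * t n) atTop atTop

/-- The uniform distribution on `Fin d`. -/
def unif (d : ℕ) : Fin d → ℝ := fun _ => 1 / (d : ℝ)

/-- The embedding map `Γ` associated with `γ_i = c_i / N`: for each `i` it produces
`c_i` entries equal to `a_i / c_i`. -/
def embed {d : ℕ} (c : Fin d → ℕ) (a : Fin d → ℝ) : (Σ i : Fin d, Fin (c i)) → ℝ :=
  fun x => a x.1 / (c x.1 : ℝ)

/-- Cut-and-pile modification of the sorted version of `a`, with cut at `K`: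
the first entry absorbs the total mass of entries at (1-based) positions `≥ K`,
entries at positions `1 < i < K` are unchanged, and entries at positions `≥ K` are set to 0. -/
def cutAndPile {α : Type*} [Fintype α] (a : α → ℝ) (K : ℝ) : Fin (Fintype.card α) → ℝ :=
  fun i =>
    if (i : ℕ) = 0 then descSorted a i + tailSum a K
    else if ((i : ℕ) + 1 : ℝ) < K then descSorted a i else 0

/-! ### Masses of events -/

/-- The mass that the weight `w` assigns to the event `s`. -/
def mass {α : Type*} [Fintype α] (w : α → ℝ) (s : Set α) : ℝ :=
  ∑ x, s.indicator w x

section Mass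

variable {α : Type*} [Fintype α] {w : α → ℝ} {s t : Set α}

theorem mass_nonneg (hw : ∀ x, 0 ≤ w x) : 0 ≤ mass w s :=
  Finset.sum_nonneg fun x _ => Set.indicator_nonneg (fun x _ => hw x) x

theorem mass_mono (hw : ∀ x, 0 ≤ w x) (h : ∀ x, w x ≠ 0 → x ∈ s → x ∈ t) :
    mass w s ≤ mass w t := by
  classical
  refine Finset.sum_le_sum fun x _ => ?_
  by_cases hx : w x = 0
  · simp [Set.indicator_apply, hx]
  · by_cases hs : x ∈ s
    · rw [Set.indicator_of_mem hs, Set.indicator_of_mem (h x hx hs)]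
    · rw [Set.indicator_of_notMem hs]
      exact Set.indicator_nonneg (fun x _ => hw x) x

theorem mass_add_mass_compl (w : α → ℝ) (s : Set α) : mass w s + mass w sᶜ = ∑ x, w x := by
  rw [mass, mass, ← Finset.sum_add_distrib]
  exact Finset.sum_congr rfl fun x _ => congrFun (Set.indicator_self_add_compl s w) x

theorem mass_eq_sum_filter (w : α → ℝ) (s : Set α) [DecidablePred (· ∈ s)] :
    mass w s = ∑ x with x ∈ s, w x := by
  rw [mass, Finset.sum_filter]
  exact Finset.sum_congr rfl fun x _ => Set.indicator_apply s w x

end Mass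

/-! ### Partial sums of sorted vectors -/

section HeadSum

variable {α β : Type*} [Fintype α] [Fintype β]

/-- The enumeration of `α` along which `a` is non-increasing. -/
def descEquiv (a : α → ℝ) : Fin (Fintype.card α) ≃ α :=
  (Tuple.sort (fun j => -a ((Fintype.equivFin α).symm j))).trans (Fintype.equivFin α).symm

theorem descSorted_eq (a : α → ℝ) (i : Fin (Fintype.card α)) :
    descSorted a i = a (descEquiv a i) := rfl

theorem descSorted_antitone (a : α → ℝ) : Antitone (descSorted a) := by
  intro i j hij
  have := Tuple.monotone_sort (fun j => -a ((Fintype.equivFin α).symm j)) hij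
  simp only [Function.comp_apply] at this
  exact neg_le_neg_iff.mp this

theorem headSum_natCast (a : α → ℝ) (k : ℕ) :
    headSum a k =
      ∑ i ∈ Finset.univ.filter (fun i : Fin (Fintype.card α) => (i : ℕ) < k), descSorted a i := by
  unfold headSum
  congr 1
  ext i
  simp only [Finset.mem_filter, Finset.mem_univ, true_and]
  norm_cast

theorem exists_headSum_eq (a : α → ℝ) (k : ℕ) :
    ∃ A : Finset α, A.card ≤ k ∧ headSum a k = ∑ x ∈ A, a x := by
  classical
  refine ⟨(Finset.univ.filter (fun i : Fin (Fintype.card α) => (i : ℕ) < k)).map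
    (descEquiv a).toEmbedding, ?_, ?_⟩
  · rw [Finset.card_map]
    have : (Finset.univ.filter (fun i : Fin (Fintype.card α) => (i : ℕ) < k)).card
        ≤ (Finset.range k).card := by
      refine Finset.card_le_card_of_injOn (fun i => (i : ℕ)) ?_ ?_
      · intro i hi
        simpa using hi
      · intro i _ j _ h
        exact Fin.ext h
    simpa using this
  · rw [headSum_natCast, Finset.sum_map]
    rfl

theorem sum_mul_le_headSum {a : α → ℝ} (ha : ∀ x, 0 ≤ a x) {φ : α → ℝ} (h0 : ∀ x, 0 ≤ φ x)
    (h1 : ∀ x, φ x ≤ 1) {k : ℕ} (hk : ∑ x, φ x ≤ k) : ∑ x, φ x * a x ≤ headSum a k := by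
  classical
  rw [headSum_natCast, ← (descEquiv a).sum_comp (fun x => φ x * a x), Finset.sum_filter]
  rcases le_or_gt (Fintype.card α) k with hc | hc
  · refine Finset.sum_le_sum fun i _ => ?_
    rw [if_pos (lt_of_lt_of_le i.2 hc), descSorted_eq]
    exact mul_le_of_le_one_left (ha _) (h1 _)
  · set τ := descSorted a ⟨k, hc⟩ with hτ
    have hτ0 : 0 ≤ τ := ha _
    have key : ∀ i : Fin (Fintype.card α), φ (descEquiv a i) * a (descEquiv a i) ≤
        (if (i : ℕ) < k then descSorted a i else 0) +
          τ * (φ (descEquiv a i) - if (i : ℕ) < k then 1 else 0) := by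
      intro i
      rw [← descSorted_eq a i]
      have hφ0 := h0 (descEquiv a i)
      have hφ1 := h1 (descEquiv a i)
      split_ifs with hi
      · have : τ ≤ descSorted a i := descSorted_antitone a (by
          rw [Fin.le_def]; exact hi.le)
        nlinarith
      · have : descSorted a i ≤ τ := descSorted_antitone a (by
          rw [Fin.le_def]; exact not_lt.mp hi)
        nlinarith
    have hcount : ∑ i : Fin (Fintype.card α), (if (i : ℕ) < k then (1 : ℝ) else 0) = k := by
      rw [← Finset.sum_filter, Finset.sum_const, nsmul_eq_mul, mul_one]
      have := Fin.card_filter_val_lt (n := Fintype.card α) (m := k)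
      rw [this, min_eq_right hc.le]
    calc _ ≤ ∑ i : Fin (Fintype.card α), ((if (i : ℕ) < k then descSorted a i else 0) +
          τ * (φ (descEquiv a i) - if (i : ℕ) < k then 1 else 0)) :=
          Finset.sum_le_sum fun i _ => key i
      _ = (∑ i : Fin (Fintype.card α), if (i : ℕ) < k then descSorted a i else 0) +
          τ * ((∑ x, φ x) - k) := by
          rw [Finset.sum_add_distrib, ← Finset.mul_sum, Finset.sum_sub_distrib, hcount,
            (descEquiv a).sum_comp φ]
      _ ≤ _ := by nlinarith

theorem sum_le_headSum {a : α → ℝ} (ha : ∀ x, 0 ≤ a x) (A : Finset α) :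
    ∑ x ∈ A, a x ≤ headSum a A.card := by
  classical
  have := sum_mul_le_headSum ha (φ := fun x => if x ∈ A then 1 else 0) (k := A.card)
    (fun x => by positivity) (fun x => by split_ifs <;> norm_num) (by simp)
  simpa using this

/-- Splitting at the level `c` bounds a partial sum of the sorted vector. -/
theorem headSum_le_mass_add {a : α → ℝ} (ha : ∀ x, 0 ≤ a x) (k : ℕ) {c : ℝ} (hc : 0 ≤ c) :
    headSum a k ≤ mass a {x | c < a x} + k * c := by
  classical
  obtain ⟨A, hA, hs⟩ := exists_headSum_eq a k
  rw [hs]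
  calc ∑ x ∈ A, a x ≤ ∑ x ∈ A, ({x | c < a x}.indicator a x + c) := by
        refine Finset.sum_le_sum fun x _ => ?_
        rw [Set.indicator_apply]
        split_ifs with h
        · linarith
        · simpa using h
    _ = ∑ x ∈ A, {x | c < a x}.indicator a x + A.card * c := by
        rw [Finset.sum_add_distrib, Finset.sum_const, nsmul_eq_mul]
    _ ≤ _ := by
        refine add_le_add ?_ ?_
        · exact Finset.sum_le_sum_of_subset_of_nonneg (Finset.subset_univ _)
            fun x _ _ => Set.indicator_nonneg (fun x _ => ha x) x
        · exact mul_le_mul_of_nonneg_right (by exact_mod_cast hA) hc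

theorem sum_le_sum_add_tvd {b b' : α → ℝ} (hb : ∑ x, b x = 1) (hb' : ∑ x, b' x = 1)
    (A : Finset α) : ∑ x ∈ A, b x ≤ ∑ x ∈ A, b' x + tvd b b' := by
  classical
  have h1 := Finset.sum_add_sum_compl A (fun x => b x - b' x)
  have h2 := Finset.sum_add_sum_compl A (fun x => |b x - b' x|)
  have h3 : ∑ x, (b x - b' x) = 0 := by rw [Finset.sum_sub_distrib, hb, hb', sub_self]
  have h4 : ∑ x ∈ A, (b x - b' x) ≤ ∑ x ∈ A, |b x - b' x| :=
    Finset.sum_le_sum fun x _ => le_abs_self _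
  have h5 : -∑ x ∈ Aᶜ, (b x - b' x) ≤ ∑ x ∈ Aᶜ, |b x - b' x| := by
    rw [← Finset.sum_neg_distrib]
    exact Finset.sum_le_sum fun x _ => neg_le_abs _
  have h6 : ∑ x ∈ A, (b x - b' x) = ∑ x ∈ A, b x - ∑ x ∈ A, b' x := Finset.sum_sub_distrib _ _
  unfold tvd
  linarith

/-- The testing inequality implied by approximate majorisation. -/
theorem ApproxMajTV.sum_le {a : α → ℝ} {b : β → ℝ} {e : ℝ} (h : ApproxMajTV a b e)
    (ha : IsProbDist a) (hb : IsProbDist b) (A : Finset β) {c : ℝ} (hc : 0 ≤ c) :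
    ∑ y ∈ A, b y ≤ mass a {x | c < a x} + A.card * c + e := by
  obtain ⟨bt, hbt, hmaj, htv⟩ := h
  have h1 := sum_le_sum_add_tvd hb.2 hbt.2 A
  have h2 := sum_le_headSum hbt.1 A
  have h3 := hmaj A.card
  have h4 := headSum_le_mass_add ha.1 A.card hc
  linarith

/-- If `b` is mostly spread below the level `u / N` and `a` is mostly concentrated above the
level `u' / N`, then `a` approximately majorises `b`. -/
theorem approxMajTV_of_levels {a : α → ℝ} {b : β → ℝ} (ha : IsProbDist a) (hb : IsProbDist b)
    (hcard : Fintype.card β = Fintype.card α) (hN : 0 < Fintype.card α)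
    {u u' μ : ℝ} (hu : 0 ≤ u) (hu2 : 2 ≤ u') (huu : u + 1 ≤ u') (hμ0 : 0 ≤ μ) (hμ1 : μ ≤ 1)
    (hlow : mass a {x | a x < u' / Fintype.card α} ≤ μ / 2)
    (hhigh : mass b {y | u / Fintype.card α < b y} ≤ μ) : ApproxMajTV a b (2 * μ) := by
  classical
  set N : ℝ := (Fintype.card α : ℝ) with hNdef
  have hN0 : 0 < N := Nat.cast_pos.mpr hN
  have hNβ : ∑ _y : β, (1 : ℝ) = N := by simp [hcard, hNdef]
  have hNα : ∑ _x : α, (1 : ℝ) = N := by simp [hNdef]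
  set b' : β → ℝ := fun y => (1 - μ) * {y | u / N < b y}ᶜ.indicator b y with hb'
  have hind0 : ∀ y, 0 ≤ {y | u / N < b y}ᶜ.indicator b y :=
    fun y => Set.indicator_nonneg (fun x _ => hb.1 x) y
  have hind1 : ∀ y, {y | u / N < b y}ᶜ.indicator b y ≤ b y :=
    fun y => Set.indicator_le_self' (fun x _ => hb.1 x) y
  have hind2 : ∀ y, {y | u / N < b y}ᶜ.indicator b y ≤ u / N := by
    intro y
    rw [Set.indicator_apply]
    split_ifs with h
    · simpa using h
    · positivity
  have hb'0 : ∀ y, 0 ≤ b' y := fun y => mul_nonneg (by linarith) (hind0 y)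
  have hb'1 : ∀ y, b' y ≤ b y := fun y =>
    (mul_le_of_le_one_left (hind0 y) (by linarith)).trans (hind1 y)
  have hsum : ∑ y, b' y = (1 - μ) * (1 - mass b {y | u / N < b y}) := by
    rw [hb', ← Finset.mul_sum]
    have := mass_add_mass_compl b {y | u / N < b y}
    rw [hb.2] at this
    rw [← this]
    unfold mass
    ring
  have hm0 : 0 ≤ mass b {y | u / N < b y} := mass_nonneg hb.1
  set ρ := 1 - ∑ y, b' y with hρ
  have hρμ : μ ≤ ρ := by rw [hρ, hsum]; nlinarith
  have hρ2 : ρ ≤ 2 * μ := by rw [hρ, hsum]; nlinarith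
  have hρ1 : ρ ≤ 1 := by
    rw [hρ]; linarith [Finset.sum_nonneg fun y (_ : y ∈ Finset.univ) => hb'0 y]
  have hρ0 : 0 ≤ ρ := hμ0.trans hρμ
  set bt : β → ℝ := fun y => b' y + ρ / N with hbt
  have hconst : ∑ _y : β, ρ / N = ρ := by
    have : ∑ _y : β, ρ / N = ρ / N * ∑ _y : β, (1 : ℝ) := by simp [mul_comm]
    rw [this, hNβ]
    field_simp
  have hbt0 : ∀ y, 0 ≤ bt y := fun y => add_nonneg (hb'0 y) (by positivity)
  have hbtsum : ∑ y, bt y = 1 := by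
    rw [hbt, Finset.sum_add_distrib, hconst, hρ]
    ring
  have hbtmin : ∀ y, μ / N ≤ bt y := fun y => by
    have : μ / N ≤ ρ / N := by gcongr
    have := hb'0 y
    simp only [hbt]
    linarith
  have hbtmax : ∀ y, bt y ≤ u' / N := fun y => by
    have h1 : b' y ≤ u / N :=
      (mul_le_of_le_one_left (hind0 y) (by linarith)).trans (hind2 y)
    have h2 : ρ / N ≤ 1 / N := by gcongr
    have h3 : u / N + 1 / N ≤ u' / N := by rw [← add_div]; gcongr
    simp only [hbt]
    linarith
  refine ⟨bt, ⟨hbt0, hbtsum⟩, ?_, ?_⟩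
  · intro j
    set A : Finset α := Finset.univ.filter (fun x => u' / N ≤ a x) with hA
    have hmassA : ∑ x ∈ A, a x = 1 - mass a {x | a x < u' / N} := by
      rw [← ha.2, ← mass_add_mass_compl a {x | a x < u' / N}, mass_eq_sum_filter _ _ᶜ]
      simp [hA]
    have hAlow : A.card * (u' / N) ≤ ∑ x ∈ A, a x := by
      rw [← nsmul_eq_mul]
      exact Finset.card_nsmul_le_sum _ _ _ fun x hx => (Finset.mem_filter.mp hx).2
    have hmlow0 : 0 ≤ mass a {x | a x < u' / N} := mass_nonneg ha.1
    have hAcard : (A.card : ℝ) ≤ N / 2 := by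
      have h1 : A.card * (u' / N) ≤ 1 := by linarith
      have h2 : A.card * (2 / N) ≤ A.card * (u' / N) := by gcongr
      have h3 : A.card * (2 / N) = 2 * A.card / N := by ring
      have h4 : 2 * A.card / N ≤ 1 := by linarith
      rw [div_le_one hN0] at h4
      linarith
    obtain ⟨B, hBj, hBs⟩ := exists_headSum_eq bt j
    rcases lt_or_ge j A.card with hj | hj
    · have hA0 : (0 : ℝ) < A.card := by exact_mod_cast (Nat.zero_le j).trans_lt hj
      have hjA : (j : ℝ) / A.card ≤ 1 := by
        rw [div_le_one hA0]; exact_mod_cast hj.le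
      have h1 := sum_mul_le_headSum ha.1 (φ := fun x => if x ∈ A then (j : ℝ) / A.card else 0)
        (k := j) (fun x => by positivity) (fun x => by split_ifs <;> linarith)
        (by
          rw [← Finset.sum_filter, Finset.sum_const, nsmul_eq_mul]
          simp only [Finset.filter_mem_eq_inter, Finset.univ_inter]
          rw [mul_div_cancel₀ _ hA0.ne'])
      have h2 : ∑ x, (if x ∈ A then (j : ℝ) / A.card else 0) * a x
          = (j : ℝ) / A.card * ∑ x ∈ A, a x := by
        simp only [ite_mul, zero_mul]
        rw [← Finset.sum_filter, Finset.mul_sum]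
        simp
      have h3 : (j : ℝ) * (u' / N) ≤ (j : ℝ) / A.card * ∑ x ∈ A, a x := by
        calc (j : ℝ) * (u' / N) = (j : ℝ) / A.card * (A.card * (u' / N)) := by
              field_simp
          _ ≤ _ := by gcongr
      have h4 : ∑ y ∈ B, bt y ≤ j * (u' / N) := by
        calc ∑ y ∈ B, bt y ≤ B.card • (u' / N) :=
              Finset.sum_le_card_nsmul _ _ _ fun y _ => hbtmax y
          _ = B.card * (u' / N) := nsmul_eq_mul _ _
          _ ≤ j * (u' / N) := by gcongr
      rw [hBs]
      linarith
    · rcases lt_or_ge (j : ℝ) N with hjN | hjN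
      · have hpos : 0 < N - A.card := by linarith
        have hjA : (A.card : ℝ) ≤ j := by exact_mod_cast hj
        set s : ℝ := (j - A.card) / (N - A.card) with hs
        have hs0 : 0 ≤ s := div_nonneg (by linarith) hpos.le
        have hs1 : s ≤ 1 := by rw [hs, div_le_one hpos]; linarith
        have hsum2 : ∀ g : α → ℝ, ∑ x, (if x ∈ A then 1 else s) * g x
            = ∑ x ∈ A, g x + s * (∑ x, g x - ∑ x ∈ A, g x) := by
          intro g
          rw [← Finset.sum_add_sum_compl A g, ← Finset.sum_add_sum_compl A, add_sub_cancel_left,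
            Finset.mul_sum]
          congr 1
          · exact Finset.sum_congr rfl fun x hx => by simp [hx]
          · exact Finset.sum_congr rfl fun x hx => by simp [Finset.mem_compl.mp hx]
        have h1 := sum_mul_le_headSum ha.1 (φ := fun x => if x ∈ A then 1 else s)
          (k := j) (fun x => by positivity) (fun x => by split_ifs <;> linarith)
          (by
            have := hsum2 (fun _ => 1)
            simp only [mul_one] at this
            rw [this, hNα, Finset.sum_const, nsmul_eq_mul, mul_one, hs, div_mul_cancel₀ _ hpos.ne']
            linarith)
        rw [hsum2, ha.2, hmassA] at h1
        have h2 : 1 - s ≤ 2 * (N - j) / N := by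
          have : 1 - s = (N - j) / (N - A.card) := by
            rw [hs]; field_simp; ring
          rw [this, div_le_div_iff₀ hpos hN0]
          nlinarith
        have h3 : ∑ y ∈ B, bt y ≤ 1 - (N - j) * (μ / N) := by
          have hc : ((Bᶜ).card : ℝ) = N - B.card := by
            rw [Finset.card_compl, Nat.cast_sub (Finset.card_le_univ _), hcard]
          have h5 : (Bᶜ).card * (μ / N) ≤ ∑ y ∈ Bᶜ, bt y := by
            rw [← nsmul_eq_mul]
            exact Finset.card_nsmul_le_sum _ _ _ fun x _ => hbtmin x
          have h6 := Finset.sum_add_sum_compl B bt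
          have h7 : (N - j) * (μ / N) ≤ (N - B.card) * (μ / N) := by gcongr
          rw [hc] at h5
          linarith
        have h4 : (1 - s) * mass a {x | a x < u' / N} ≤ (N - j) * (μ / N) := by
          calc _ ≤ 2 * (N - j) / N * (μ / 2) := by
                apply mul_le_mul h2 hlow hmlow0
                have : 0 < N - j := by linarith
                positivity
            _ = _ := by ring
        rw [hBs]
        nlinarith
      · have h1 := sum_mul_le_headSum ha.1 (φ := fun _ => 1) (k := j) (fun _ => by norm_num)
          (fun _ => le_rfl) (by rw [hNα]; exact hjN)
        simp only [one_mul] at h1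
        have h2 : ∑ y ∈ B, bt y ≤ ∑ y, bt y :=
          Finset.sum_le_sum_of_subset_of_nonneg (Finset.subset_univ _) fun y _ _ => hbt0 y
        rw [hBs]
        linarith [ha.2]
  · have h1 : ∑ y, |b y - bt y| ≤ ∑ y, ((b y - b' y) + ρ / N) := by
      refine Finset.sum_le_sum fun y _ => ?_
      have h2 := hb'1 y
      have h3 : 0 ≤ ρ / N := by positivity
      simp only [hbt]
      rw [abs_le]
      constructor <;> linarith
    rw [Finset.sum_add_distrib, Finset.sum_sub_distrib, hconst, hb.2] at h1
    unfold tvd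
    linarith

end HeadSum

/-! ### Product weights and log-likelihood ratios -/

section Product

variable {d : ℕ} {p q : Fin d → ℝ}

/-- The log-likelihood ratio of `n` independent samples against the uniform distribution. -/
def llr (p : Fin d → ℝ) (n : ℕ) (f : Fin n → Fin d) : ℝ :=
  ∑ j, Real.log (p (f j) / unif d (f j))

theorem sum_tpow {α : Type*} [Fintype α] (a : α → ℝ) (n : ℕ) :
    ∑ f, tpow a n f = (∑ i, a i) ^ n := by
  classical
  exact (Fintype.sum_pow a n).symm

theorem IsProbDist.tpow {α : Type*} [Fintype α] {a : α → ℝ} (ha : IsProbDist a) (n : ℕ) :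
    IsProbDist (tpow a n) :=
  ⟨fun _ => Finset.prod_nonneg fun _ _ => ha.1 _, by rw [sum_tpow, ha.2, one_pow]⟩

theorem IsProbDist.tensor {α β : Type*} [Fintype α] [Fintype β] {a : α → ℝ} {b : β → ℝ}
    (ha : IsProbDist a) (hb : IsProbDist b) : IsProbDist (tensor a b) := by
  refine ⟨fun _ => mul_nonneg (ha.1 _) (hb.1 _), ?_⟩
  unfold _root_.tensor
  rw [← Finset.univ_product_univ, Finset.sum_product]
  simp only [← Finset.mul_sum, hb.2, mul_one, ha.2]

theorem isProbDist_unif (hd : 0 < d) : IsProbDist (unif d) := by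
  refine ⟨fun _ => by unfold unif; positivity, ?_⟩
  have : (d : ℝ) ≠ 0 := by positivity
  simp [unif, this]

theorem tpow_unif (d n : ℕ) (f : Fin n → Fin d) : tpow (unif d) n f = 1 / (d : ℝ) ^ n := by
  simp [tpow, unif]

theorem tpow_eq_exp_llr (hd : 0 < d) (hp : ∀ i, 0 ≤ p i) {n : ℕ} {f : Fin n → Fin d}
    (hf : tpow p n f ≠ 0) : tpow p n f = Real.exp (llr p n f) / (d : ℝ) ^ n := by
  have hd' : (0 : ℝ) < d := by exact_mod_cast hd
  have h : ∀ j, Real.exp (Real.log (p (f j) / unif d (f j))) = p (f j) * d := by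
    intro j
    have h1 : p (f j) ≠ 0 := fun h0 => hf (Finset.prod_eq_zero (Finset.mem_univ j) h0)
    have h2 : 0 < p (f j) := lt_of_le_of_ne (hp _) h1.symm
    rw [Real.exp_log (div_pos h2 (by unfold unif; positivity))]
    simp [unif]
  rw [llr, Real.exp_sum]
  simp only [h, Finset.prod_mul_distrib, Finset.prod_const, Finset.card_univ, Fintype.card_fin]
  rw [mul_div_cancel_right₀ _ (by positivity)]
  rfl

theorem sum_prod_mul_castAdd {α : Type*} [Fintype α] (a : α → ℝ) (m r : ℕ)
    (ψ : (Fin m → α) → ℝ) :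
    ∑ f : Fin (m + r) → α, tpow a (m + r) f * ψ (fun i => f (Fin.castAdd r i)) =
      (∑ g, tpow a m g * ψ g) * (∑ i, a i) ^ r := by
  classical
  rw [← (Fin.appendEquiv m r).sum_comp, ← Finset.univ_product_univ, ← sum_tpow a r,
    Finset.sum_mul_sum, Finset.sum_product]
  refine Finset.sum_congr rfl fun g _ => Finset.sum_congr rfl fun g' _ => ?_
  simp only [Fin.appendEquiv_apply, tpow, Fin.prod_univ_add, Fin.append_left, Fin.append_right]
  ring

theorem mass_tensor_fst {α β : Type*} [Fintype α] [Fintype β] (a : α → ℝ) {b : β → ℝ}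
    (hb : ∑ y, b y = 1) (s : Set α) : mass (tensor a b) {x | x.1 ∈ s} = mass a s := by
  classical
  unfold mass
  rw [← Finset.univ_product_univ, Finset.sum_product]
  refine Finset.sum_congr rfl fun x _ => ?_
  by_cases hx : x ∈ s
  · simp [hx, tensor, ← Finset.mul_sum, hb]
  · simp [hx]

theorem mass_tensor_fst_le {α β : Type*} [Fintype α] [Fintype β] {a : α → ℝ} {b : β → ℝ}
    (ha : IsProbDist a) (hb : IsProbDist b) {S : Set (α × β)} {s : Set α}
    (h : ∀ x, a x.1 ≠ 0 → x ∈ S → x.1 ∈ s) : mass (tensor a b) S ≤ mass a s := by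
  rw [← mass_tensor_fst a hb.2 s]
  exact mass_mono (ha.tensor hb).1 fun x hx hxS => h x (left_ne_zero_of_mul hx) hxS

/-- Approximate majorisation of product distributions compares the tails of the log-likelihood
ratios, also after discarding some of the target samples. -/
theorem ApproxMajTV.mass_le (hd : 0 < d) (hp : IsProbDist p) (hq : IsProbDist q)
    {n m m' : ℕ} {e : ℝ}
    (h : ApproxMajTV (tensor (tpow p n) (tpow (unif d) m)) (tensor (tpow q m) (tpow (unif d) n)) e)
    (hm : m' ≤ m) (x y : ℝ) :
    mass (tpow q m') {f | x ≤ llr q m' f} ≤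
      mass (tpow p n) {f | y < llr p n f} + Real.exp (y - x) + e := by
  classical
  obtain ⟨r, rfl⟩ := Nat.exists_eq_add_of_le hm
  have hd' : (0 : ℝ) < d := by exact_mod_cast hd
  have hu := isProbDist_unif hd
  set S : Set (Fin m' → Fin d) := {f | x ≤ llr q m' f ∧ tpow q m' f ≠ 0} with hS
  set A : Finset ((Fin (m' + r) → Fin d) × (Fin n → Fin d)) :=
    (Finset.univ.filter fun f => (fun i => f (Fin.castAdd r i)) ∈ S) ×ˢ Finset.univ with hA
  set B : Finset (Fin m' → Fin d) := Finset.univ.filter (· ∈ S) with hB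
  have hmarg : ∀ a : Fin d → ℝ,
      ∑ f with (fun i => f (Fin.castAdd r i)) ∈ S, tpow a (m' + r) f =
        (∑ f ∈ B, tpow a m' f) * (∑ i, a i) ^ r := by
    intro a
    have := sum_prod_mul_castAdd a m' r (fun g => if g ∈ S then 1 else 0)
    simpa [Finset.sum_filter, hB] using this
  have hcard : (A.card : ℝ) = B.card * d ^ r * d ^ n := by
    have h1 := hmarg (fun _ => 1)
    simp only [tpow, Finset.prod_const_one, Finset.sum_const, nsmul_eq_mul, mul_one,
      Finset.card_univ, Fintype.card_fin] at h1
    rw [hA, Finset.card_product, Nat.cast_mul, h1]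
    simp
  have hsumA : ∑ z ∈ A, tensor (tpow q (m' + r)) (tpow (unif d) n) z = ∑ f ∈ B, tpow q m' f := by
    have h1 := hmarg q
    rw [hq.2, one_pow, mul_one] at h1
    rw [hA, Finset.sum_product, ← h1]
    refine Finset.sum_congr rfl fun f _ => ?_
    simp only [tensor]
    rw [← Finset.mul_sum, (hu.tpow n).2, mul_one]
  have hBcard : B.card * (Real.exp x / d ^ m') ≤ 1 := by
    calc B.card * (Real.exp x / d ^ m') = B.card • (Real.exp x / d ^ m') :=
          (nsmul_eq_mul _ _).symm
      _ ≤ ∑ f ∈ B, tpow q m' f := by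
          refine Finset.card_nsmul_le_sum _ _ _ fun f hf => ?_
          have hf' : f ∈ S := (Finset.mem_filter.mp hf).2
          rw [tpow_eq_exp_llr hd hq.1 hf'.2]
          have := hf'.1
          gcongr
      _ ≤ ∑ f, tpow q m' f := Finset.sum_le_sum_of_subset_of_nonneg (Finset.subset_univ _)
          fun f _ _ => (hq.tpow m').1 f
      _ = 1 := (hq.tpow m').2
  have hleft : mass (tpow q m') {f | x ≤ llr q m' f} ≤ ∑ f ∈ B, tpow q m' f := by
    rw [hB, ← mass_eq_sum_filter]
    exact mass_mono (hq.tpow m').1 fun f hf hx => ⟨hx, hf⟩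
  have hright : mass (tensor (tpow p n) (tpow (unif d) (m' + r)))
      {z | Real.exp y / d ^ (n + (m' + r)) <
        tensor (tpow p n) (tpow (unif d) (m' + r)) z} ≤
      mass (tpow p n) {f | y < llr p n f} := by
    refine mass_tensor_fst_le (hp.tpow n) (hu.tpow _) fun z hz hlt => ?_
    simp only [Set.mem_ofPred_eq, tensor, tpow_unif] at hlt ⊢
    rw [tpow_eq_exp_llr hd hp.1 hz, div_mul_div_comm, mul_one, ← pow_add] at hlt
    have := (div_lt_div_iff_of_pos_right (by positivity)).mp hlt
    exact Real.exp_lt_exp.mp this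
  have hmain := h.sum_le ((hp.tpow n).tensor (hu.tpow _)) ((hq.tpow _).tensor (hu.tpow n)) A
    (c := Real.exp y / d ^ (n + (m' + r))) (by positivity)
  have hmid : A.card * (Real.exp y / d ^ (n + (m' + r))) ≤ Real.exp (y - x) := by
    rw [hcard, Real.exp_sub, le_div_iff₀ (Real.exp_pos x)]
    calc _ = B.card * (Real.exp x / d ^ m') * Real.exp y := by
          rw [pow_add, pow_add]
          field_simp
      _ ≤ 1 * Real.exp y := by gcongr
      _ = _ := one_mul _
  linarith

/-- Approximate majorisation of product distributions from concentration of the log-likelihood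
ratios. -/
theorem approxMajTV_of_llr (hd : 0 < d) (hp : IsProbDist p) (hq : IsProbDist q)
    {n m : ℕ} {x y e : ℝ} (hx : 0 ≤ x) (hxy : x + 1 ≤ y) (he0 : 0 ≤ e) (he1 : e ≤ 1)
    (hlow : mass (tpow p n) {f | llr p n f < y} ≤ e / 4)
    (hhigh : mass (tpow q m) {f | x < llr q m f} ≤ e / 2) :
    ApproxMajTV (tensor (tpow p n) (tpow (unif d) m)) (tensor (tpow q m) (tpow (unif d) n)) e := by
  have hd' : (0 : ℝ) < d := by exact_mod_cast hd
  have hu := isProbDist_unif hd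
  have hcard : (Fintype.card ((Fin n → Fin d) × (Fin m → Fin d)) : ℝ) = d ^ (n + m) := by
    simp [pow_add]
  have hx1 : 1 ≤ Real.exp x := Real.one_le_exp hx
  have hy : 2 * Real.exp x ≤ Real.exp y := by
    have h1 : Real.exp (x + 1) ≤ Real.exp y := Real.exp_le_exp.mpr hxy
    rw [Real.exp_add] at h1
    have h2 : 2 ≤ Real.exp 1 := by linarith [Real.add_one_le_exp (1 : ℝ)]
    nlinarith
  have := approxMajTV_of_levels ((hp.tpow n).tensor (hu.tpow m)) ((hq.tpow m).tensor (hu.tpow n))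
    (by simp [mul_comm]) (by
      have : (0 : ℝ) < Fintype.card ((Fin n → Fin d) × (Fin m → Fin d)) := by
        rw [hcard]; positivity
      exact_mod_cast this)
    (u := Real.exp x) (u' := Real.exp y) (μ := e / 2) (Real.exp_pos x).le (by linarith)
    (by linarith) (by linarith) (by linarith) ?_ ?_
  · convert! this using 1
    ring
  · rw [hcard]
    refine (mass_tensor_fst_le (hp.tpow n) (hu.tpow m) fun z hz hlt => ?_).trans
      (hlow.trans (by linarith))
    simp only [Set.mem_ofPred_eq, tensor, tpow_unif] at hlt ⊢
    rw [tpow_eq_exp_llr hd hp.1 hz, div_mul_div_comm, mul_one, ← pow_add] at hlt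
    exact Real.exp_lt_exp.mp ((div_lt_div_iff_of_pos_right (by positivity)).mp hlt)
  · rw [hcard]
    refine (mass_tensor_fst_le (hq.tpow m) (hu.tpow n) fun z hz hlt => ?_).trans hhigh
    simp only [Set.mem_ofPred_eq, tensor, tpow_unif] at hlt ⊢
    rw [tpow_eq_exp_llr hd hq.1 hz, div_mul_div_comm, mul_one, ← pow_add, add_comm m n] at hlt
    exact Real.exp_lt_exp.mp ((div_lt_div_iff_of_pos_right (by positivity)).mp hlt)

end Product

/-! ### Large deviations from quadratic cumulant asymptotics -/

section LargeDeviations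

/-- At speed `a`, the cumulant generating functions of `Z n` under the weights `w n` are
asymptotically those of a centred Gaussian with variance `v`. -/
def QuadraticMGF (a : ℕ → ℝ) {Ω : ℕ → Type*} [∀ n, Fintype (Ω n)] (w Z : ∀ n, Ω n → ℝ)
    (v : ℝ) : Prop :=
  ∀ θ δ : ℝ, 0 < δ → ∀ᶠ n in atTop,
    Real.exp (a n * (v * θ ^ 2 / 2 - δ)) ≤ ∑ x, w n x * Real.exp (θ * Z n x) ∧
      ∑ x, w n x * Real.exp (θ * Z n x) ≤ Real.exp (a n * (v * θ ^ 2 / 2 + δ))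

/-- Exponential Markov inequality, keeping an additional exponential weight. -/
theorem mass_mul_exp_le {α : Type*} [Fintype α] {w Z : α → ℝ} (hw : ∀ x, 0 ≤ w x) (c : ℝ)
    (θ τ : ℝ) {s : Set α} (hs : ∀ x ∈ s, τ * c ≤ τ * Z x) :
    mass (fun x => w x * Real.exp (θ * Z x)) s ≤
      Real.exp (-(τ * c)) * ∑ x, w x * Real.exp ((θ + τ) * Z x) := by
  classical
  rw [mass, Finset.mul_sum]
  refine Finset.sum_le_sum fun x _ => ?_
  have h0 := hw x
  by_cases hx : x ∈ s
  · rw [Set.indicator_of_mem hx]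
    calc w x * Real.exp (θ * Z x) ≤ w x * Real.exp (-(τ * c) + (θ + τ) * Z x) := by
          have := hs x hx
          gcongr
          linarith
      _ = _ := by rw [Real.exp_add]; ring
  · rw [Set.indicator_of_notMem hx]
    positivity

variable {a : ℕ → ℝ} {Ω : ℕ → Type*} [∀ n, Fintype (Ω n)] {w Z : ∀ n, Ω n → ℝ} {v : ℝ}

theorem QuadraticMGF.neg (h : QuadraticMGF a w Z v) : QuadraticMGF a w (fun n x => -Z n x) v := by
  intro θ δ hδ
  simpa using h (-θ) δ hδ

/-- Upper bound on tails beyond the level at which the rate function equals one. -/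
theorem QuadraticMGF.mass_le (h : QuadraticMGF a w Z v) (hw : ∀ n x, 0 ≤ w n x) (hv : 0 < v)
    {x : ℝ} (hx : Real.sqrt (2 * v) < x) :
    ∃ δ > 0, ∀ᶠ n in atTop,
      mass (w n) {ω | a n * x ≤ Z n ω} ≤ Real.exp (-(a n * (1 + δ))) := by
  have hx0 : 0 < x := (Real.sqrt_nonneg _).trans_lt hx
  have hx2 : 2 * v < x ^ 2 := (Real.sqrt_lt' hx0).mp hx
  set δ := (x ^ 2 / (2 * v) - 1) / 2 with hδ
  have hδ0 : 0 < δ := by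
    have : 1 < x ^ 2 / (2 * v) := by rwa [one_lt_div (by positivity)]
    rw [hδ]; linarith
  refine ⟨δ, hδ0, ?_⟩
  filter_upwards [h (x / v) δ hδ0] with n hn
  have h1 := mass_mul_exp_le (Z := Z n) (hw n) (a n * x) 0 (x / v)
    (s := {ω | a n * x ≤ Z n ω}) (fun ω hω => by
      have hω' : a n * x ≤ Z n ω := hω
      gcongr)
  simp only [zero_mul, Real.exp_zero, mul_one, zero_add] at h1
  refine h1.trans ?_
  calc _ ≤ Real.exp (-(x / v * (a n * x))) *
        Real.exp (a n * (v * (x / v) ^ 2 / 2 + δ)) := by gcongr; exact hn.2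
    _ = _ := by
        rw [← Real.exp_add]
        congr 1
        rw [hδ]
        field_simp
        ring

/-- Lower bound on tails before the level at which the rate function equals one, by exponential
tilting. -/
theorem QuadraticMGF.le_mass (h : QuadraticMGF a w Z v) (hw : ∀ n x, 0 ≤ w n x) (hv : 0 < v)
    (ha : Tendsto a atTop atTop) {x : ℝ} (hx0 : 0 ≤ x) (hx : x < Real.sqrt (2 * v)) :
    ∃ δ > 0, ∀ᶠ n in atTop,
      Real.exp (-(a n * (1 - δ))) ≤ mass (w n) {ω | a n * x ≤ Z n ω} := by
  have hx2 : x ^ 2 < 2 * v := by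
    have := (Real.lt_sqrt hx0).mp hx
    exact this
  obtain ⟨η, hη0, hη⟩ : ∃ η > 0, (x + η) * (x + 3 * η) / (2 * v) + η ^ 2 / (8 * v) < 1 := by
    have hcont : Tendsto (fun η : ℝ => (x + η) * (x + 3 * η) / (2 * v) + η ^ 2 / (8 * v))
        (𝓝[>] 0) (𝓝 ((x + 0) * (x + 3 * 0) / (2 * v) + 0 ^ 2 / (8 * v))) := by
      apply tendsto_nhdsWithin_of_tendsto_nhds
      apply Continuous.tendsto
      fun_prop
    have hlt : (x + 0) * (x + 3 * 0) / (2 * v) + 0 ^ 2 / (8 * v) < 1 := by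
      simp only [add_zero, mul_zero, ne_eq, OfNat.ofNat_ne_zero, not_false_eq_true, zero_pow,
        zero_div]
      rw [div_lt_one (by positivity)]
      nlinarith
    obtain ⟨η, h1, h2⟩ := ((hcont.eventually_lt_const hlt).and self_mem_nhdsWithin).exists
    exact ⟨η, h2, h1⟩
  set κ := η ^ 2 / (8 * v) with hκ
  have hκ0 : 0 < κ := by positivity
  set δ := (1 - ((x + η) * (x + 3 * η) / (2 * v) + κ)) / 2 with hδ
  have hδ0 : 0 < δ := by rw [hδ]; linarith
  refine ⟨δ, hδ0, ?_⟩
  set θ := (x + η) / v with hθ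
  set τ := η / v with hτ
  have hθ0 : 0 < θ := by positivity
  have hτ0 : 0 < τ := by positivity
  have hlarge : ∀ᶠ n in atTop, Real.exp (-(a n * (2 * κ))) ≤ 1 / 4 := by
    have : Tendsto (fun n => Real.exp (-(a n * (2 * κ)))) atTop (𝓝 0) :=
      Real.tendsto_exp_neg_atTop_nhds_zero.comp (ha.atTop_mul_const (by positivity))
    exact this.eventually_le_const (by norm_num)
  have hlarge' : ∀ᶠ n in atTop, Real.exp (-(a n * δ)) ≤ 1 / 2 := by
    have : Tendsto (fun n => Real.exp (-(a n * δ))) atTop (𝓝 0) :=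
      Real.tendsto_exp_neg_atTop_nhds_zero.comp (ha.atTop_mul_const (by positivity))
    exact this.eventually_le_const (by norm_num)
  filter_upwards [h θ κ hκ0, h (θ + -τ) κ hκ0, h (θ + τ) κ hκ0, hlarge, hlarge',
    ha.eventually_ge_atTop 0] with n hn hn1 hn2 hn3 hn4 hn0
  set W : Ω n → ℝ := fun ω => w n ω * Real.exp (θ * Z n ω) with hW
  set E := Real.exp (a n * (v * θ ^ 2 / 2 - κ)) with hE
  have hWtot : E ≤ ∑ ω, W ω := hn.1
  have hbelow : mass W {ω | Z n ω < a n * x} ≤ E * (1 / 4) := by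
    refine (mass_mul_exp_le (hw n) (a n * x) θ (-τ) fun ω hω => ?_).trans ?_
    · have : Z n ω < a n * x := hω
      nlinarith
    · calc _ ≤ Real.exp (-(-τ * (a n * x))) *
            Real.exp (a n * (v * (θ + -τ) ^ 2 / 2 + κ)) := by gcongr; exact hn1.2
        _ = E * Real.exp (-(a n * (2 * κ))) := by
            rw [hE, ← Real.exp_add, ← Real.exp_add]
            congr 1
            rw [hκ, hθ, hτ]
            field_simp
            ring
        _ ≤ _ := by gcongr
  have habove : mass W {ω | a n * (x + 2 * η) ≤ Z n ω} ≤ E * (1 / 4) := by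
    refine (mass_mul_exp_le (hw n) (a n * (x + 2 * η)) θ τ fun ω hω => ?_).trans ?_
    · have : a n * (x + 2 * η) ≤ Z n ω := hω
      gcongr
    · calc _ ≤ Real.exp (-(τ * (a n * (x + 2 * η)))) *
            Real.exp (a n * (v * (θ + τ) ^ 2 / 2 + κ)) := by gcongr; exact hn2.2
        _ = E * Real.exp (-(a n * (2 * κ))) := by
            rw [hE, ← Real.exp_add, ← Real.exp_add]
            congr 1
            rw [hκ, hθ, hτ]
            field_simp
            ring
        _ ≤ _ := by gcongr
  have hwindow : ∑ ω, W ω ≤ mass W {ω | Z n ω < a n * x} +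
      mass W {ω | a n * (x + 2 * η) ≤ Z n ω} +
      Real.exp (θ * (a n * (x + 2 * η))) * mass (w n) {ω | a n * x ≤ Z n ω} := by
    classical
    simp only [mass]
    rw [Finset.mul_sum, ← Finset.sum_add_distrib, ← Finset.sum_add_distrib]
    refine Finset.sum_le_sum fun ω _ => ?_
    have hwω := hw n ω
    have hWω : 0 ≤ W ω := by simp only [hW]; positivity
    have hle : Z n ω < a n * (x + 2 * η) →
        W ω ≤ Real.exp (θ * (a n * (x + 2 * η))) * w n ω := by
      intro hlt
      rw [mul_comm]
      simp only [hW]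
      gcongr
    simp only [Set.indicator_apply, Set.mem_ofPred_eq]
    have hpos : 0 ≤ Real.exp (θ * (a n * (x + 2 * η))) * w n ω := by positivity
    split_ifs with h1 h2 h3 h3 h2 h3
    all_goals first
      | linarith
      | (have := hle (by linarith); linarith)
  have hfinal : E * (1 / 2) ≤
      Real.exp (θ * (a n * (x + 2 * η))) * mass (w n) {ω | a n * x ≤ Z n ω} := by
    linarith
  have hexp : Real.exp (-(a n * (1 - δ))) * Real.exp (θ * (a n * (x + 2 * η))) ≤ E * (1 / 2) := by
    calc _ = E * Real.exp (-(a n * δ)) := by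
          rw [hE, ← Real.exp_add, ← Real.exp_add]
          congr 1
          rw [hδ, hκ, hθ]
          field_simp
          ring
      _ ≤ _ := by gcongr
  have := hexp.trans hfinal
  rw [mul_comm] at this
  exact le_of_mul_le_mul_left this (Real.exp_pos _)

end LargeDeviations

/-! ### Moderate deviations of the log-likelihood ratio -/

section ModerateDeviations

variable {d : ℕ} {p : Fin d → ℝ}

theorem sum_mul_exp_sub_isLittleO {ι : Type*} [Fintype ι] {a c : ι → ℝ} (ha : ∑ i, a i = 1)
    (hc : ∑ i, a i * c i = 0) :
    (fun s : ℝ => ∑ i, a i * Real.exp (s * c i) - 1 - (∑ i, a i * c i ^ 2) / 2 * s ^ 2)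
      =o[𝓝 0] (fun s => s ^ 2) := by
  have h : ∀ i ∈ (Finset.univ : Finset ι), (fun s : ℝ => a i *
      (Real.exp (s * c i) - ∑ k ∈ Finset.range 3, (s * c i) ^ k / (k.factorial : ℝ)))
      =o[𝓝 0] (fun s => s ^ 2) := by
    intro i _
    have h0 : Tendsto (fun s : ℝ => s * c i) (𝓝 0) (𝓝 0) := by
      have : Continuous fun s : ℝ => s * c i := by fun_prop
      simpa using this.tendsto 0
    have h1 := (Real.exp_sub_sum_range_succ_isLittleO_pow 2).comp_tendsto h0
    refine Asymptotics.IsLittleO.const_mul_left ?_ _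
    refine h1.trans_isBigO ?_
    refine Asymptotics.IsBigO.of_bound (|c i| ^ 2) (Eventually.of_forall fun s => ?_)
    simp only [Function.comp_apply, norm_pow, norm_mul, Real.norm_eq_abs]
    rw [mul_pow, mul_comm]
  refine (Asymptotics.IsLittleO.sum h).congr_left fun s => ?_
  have h1 : ∀ i, a i * (Real.exp (s * c i) -
      ∑ k ∈ Finset.range 3, (s * c i) ^ k / (k.factorial : ℝ)) =
      a i * Real.exp (s * c i) - a i - s * (a i * c i) - a i * c i ^ 2 * (s ^ 2 / 2) := by
    intro i
    simp [Finset.sum_range_succ, Nat.factorial]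
    ring
  simp only [Finset.sum_apply, h1, Finset.sum_sub_distrib, ← Finset.mul_sum, ← Finset.sum_mul, ha, hc]
  ring

theorem eventually_exp_le_sum_mul_exp {ι : Type*} [Fintype ι] {a c : ι → ℝ}
    (ha : ∑ i, a i = 1) (hc : ∑ i, a i * c i = 0) {δ : ℝ} (hδ : 0 < δ) :
    ∀ᶠ s : ℝ in 𝓝 0,
      Real.exp (s ^ 2 * ((∑ i, a i * c i ^ 2) / 2 - δ)) ≤ ∑ i, a i * Real.exp (s * c i) ∧
      ∑ i, a i * Real.exp (s * c i) ≤ Real.exp (s ^ 2 * ((∑ i, a i * c i ^ 2) / 2 + δ)) := by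
  set V := ∑ i, a i * c i ^ 2 with hV
  have h1 := (sum_mul_exp_sub_isLittleO ha hc).bound (half_pos hδ)
  have hc1 : Continuous fun s : ℝ => |s ^ 2 * (V / 2 - δ)| := by fun_prop
  have hc2 : Continuous fun s : ℝ => s ^ 2 * (V / 2 - δ) ^ 2 := by fun_prop
  have h2 : ∀ᶠ s : ℝ in 𝓝 0, |s ^ 2 * (V / 2 - δ)| < 1 :=
    (hc1.tendsto 0).eventually_lt_const (by simp)
  have h3 : ∀ᶠ s : ℝ in 𝓝 0, s ^ 2 * (V / 2 - δ) ^ 2 < δ / 2 :=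
    (hc2.tendsto 0).eventually_lt_const (by simpa using hδ)
  filter_upwards [h1, h2, h3] with s hs1 hs2 hs3
  rw [Real.norm_eq_abs, Real.norm_eq_abs, abs_of_nonneg (sq_nonneg s), abs_le] at hs1
  constructor
  · have h4 := (abs_le.mp (Real.abs_exp_sub_one_sub_id_le hs2.le)).2
    have h5 : (s ^ 2 * (V / 2 - δ)) ^ 2 ≤ s ^ 2 * (δ / 2) := by
      have : (s ^ 2 * (V / 2 - δ)) ^ 2 = s ^ 2 * (s ^ 2 * (V / 2 - δ) ^ 2) := by ring
      rw [this]
      gcongr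
    nlinarith
  · have h4 := Real.add_one_le_exp (s ^ 2 * (V / 2 + δ))
    nlinarith [sq_nonneg s]

theorem sum_tpow_mul_exp (p : Fin d → ℝ) (m : ℕ) (s μ : ℝ) :
    ∑ f, tpow p m f * Real.exp (s * (llr p m f - m * μ)) =
      (∑ i, p i * Real.exp (s * (Real.log (p i / unif d i) - μ))) ^ m := by
  classical
  rw [Fintype.sum_pow]
  refine Finset.sum_congr rfl fun f _ => ?_
  rw [Finset.prod_mul_distrib, ← Real.exp_sum, ← Finset.mul_sum, Finset.sum_sub_distrib]
  simp [tpow, llr]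

/-- Cumulant asymptotics of the centred log-likelihood ratio at moderate-deviation scale. -/
theorem quadraticMGF_llr (hp : IsProbDist p) {t : ℕ → ℝ} (ht : Tendsto t atTop (𝓝 0))
    {m : ℕ → ℕ} {κ : ℝ} (hκ : 0 ≤ κ) (hm : Tendsto (fun n : ℕ => (m n : ℝ) / n) atTop (𝓝 κ)) :
    QuadraticMGF (fun n => n * t n ^ 2) (fun n => tpow p (m n))
      (fun n f => t n * (llr p (m n) f - m n * relD p (unif d)))
      (κ * relV p (unif d)) := by
  intro θ δ hδ
  set μ := relD p (unif d) with hμ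
  set V := relV p (unif d) with hV
  set c : Fin d → ℝ := fun i => Real.log (p i / unif d i) - μ with hc
  have hc0 : ∑ i, p i * c i = 0 := by
    simp only [hc, mul_sub, Finset.sum_sub_distrib, ← Finset.sum_mul, hp.2, one_mul]
    rw [hμ, relD, sub_self]
  have hcV : ∑ i, p i * c i ^ 2 = V := rfl
  set δ' := δ / (κ * θ ^ 2 + 1) with hδ'
  have hden : 0 < κ * θ ^ 2 + 1 := by positivity
  have hδ'0 : 0 < δ' := by positivity
  have hδ'κ : κ * θ ^ 2 * δ' < δ := by
    rw [hδ', mul_div_assoc', div_lt_iff₀ hden]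
    nlinarith
  have hs : Tendsto (fun n => θ * t n) atTop (𝓝 0) := by simpa using ht.const_mul θ
  have hmgf := hs.eventually (eventually_exp_le_sum_mul_exp hp.2 hc0 hδ'0)
  have hup : ∀ᶠ n : ℕ in atTop, (m n : ℝ) / n * (θ ^ 2 * (V / 2 + δ')) < κ * V * θ ^ 2 / 2 + δ :=
    (hm.mul_const _).eventually_lt_const (by linarith)
  have hlo : ∀ᶠ n : ℕ in atTop, κ * V * θ ^ 2 / 2 - δ < (m n : ℝ) / n * (θ ^ 2 * (V / 2 - δ')) :=
    (hm.mul_const _).eventually_const_lt (by linarith)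
  filter_upwards [hmgf, hup, hlo, eventually_gt_atTop 0] with n h1 h2 h3 hn
  have hn' : (0 : ℝ) < n := by exact_mod_cast hn
  have hsum : ∑ f, tpow p (m n) f * Real.exp (θ * (t n * (llr p (m n) f - m n * μ))) =
      (∑ i, p i * Real.exp (θ * t n * c i)) ^ m n := by
    rw [← sum_tpow_mul_exp]
    simp only [mul_assoc]
  have hexp : ∀ x : ℝ, Real.exp ((θ * t n) ^ 2 * x) ^ m n =
      Real.exp (n * t n ^ 2 * ((m n : ℝ) / n * (θ ^ 2 * x))) := by
    intro x
    rw [← Real.exp_nat_mul]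
    congr 1
    field_simp
  rw [hcV] at h1
  rw [hsum]
  constructor
  · calc _ ≤ Real.exp (n * t n ^ 2 * ((m n : ℝ) / n * (θ ^ 2 * (V / 2 - δ')))) := by gcongr
      _ = Real.exp ((θ * t n) ^ 2 * (V / 2 - δ')) ^ m n := (hexp _).symm
      _ ≤ _ := by gcongr; exact h1.1
  · calc _ ≤ Real.exp ((θ * t n) ^ 2 * (V / 2 + δ')) ^ m n := by
          refine pow_le_pow_left₀ (Finset.sum_nonneg fun i _ => ?_) h1.2 _
          have := hp.1 i
          positivity
      _ = Real.exp (n * t n ^ 2 * ((m n : ℝ) / n * (θ ^ 2 * (V / 2 + δ')))) := hexp _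
      _ ≤ _ := by gcongr

theorem ModerateSeq.tendsto_mul_sq {t : ℕ → ℝ} (ht : ModerateSeq t) :
    Tendsto (fun n : ℕ => (n : ℝ) * t n ^ 2) atTop atTop := by
  refine (ht.2.atTop_mul_atTop₀ ht.2).congr fun n => ?_
  have := Real.mul_self_sqrt (Nat.cast_nonneg (α := ℝ) n)
  linear_combination t n ^ 2 * this

theorem ModerateSeq.tendsto_mul {t : ℕ → ℝ} (ht : ModerateSeq t) :
    Tendsto (fun n : ℕ => (n : ℝ) * t n) atTop atTop := by
  have hsqrt : Tendsto (fun n : ℕ => Real.sqrt (n : ℝ)) atTop atTop :=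
    Real.tendsto_sqrt_atTop.comp tendsto_natCast_atTop_atTop
  refine (hsqrt.atTop_mul_atTop₀ ht.2).congr fun n => ?_
  rw [← mul_assoc, Real.mul_self_sqrt (Nat.cast_nonneg n)]

theorem ModerateSeq.eventually_pos {t : ℕ → ℝ} (ht : ModerateSeq t) :
    ∀ᶠ n in atTop, 0 < t n := by
  filter_upwards [ht.2.eventually_gt_atTop 0] with n hn
  exact pos_of_mul_pos_right hn (Real.sqrt_nonneg _)

theorem ModerateSeq.eventually_exp_neg_mul_le {t : ℕ → ℝ} (ht : ModerateSeq t) {η : ℝ}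
    (hη : 0 < η) :
    ∀ᶠ n : ℕ in atTop, Real.exp (-(n * t n * η)) ≤ Real.exp (-(n * t n ^ 2)) / 4 := by
  have h1 : Tendsto (fun n : ℕ => Real.exp (-(n * t n ^ 2))) atTop (𝓝 0) :=
    Real.tendsto_exp_neg_atTop_nhds_zero.comp ht.tendsto_mul_sq
  filter_upwards [h1.eventually_le_const (show (0 : ℝ) < 1 / 4 by norm_num), ht.eventually_pos,
    ht.1.eventually_le_const (half_pos hη)] with n h2 h3 h4
  have h5 : (n : ℝ) * t n ^ 2 + n * t n ^ 2 ≤ n * t n * η := by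
    have : (0 : ℝ) ≤ n * t n := by positivity
    nlinarith
  calc Real.exp (-(n * t n * η)) ≤ Real.exp (-(n * t n ^ 2) + -(n * t n ^ 2)) := by
        gcongr; linarith
    _ = Real.exp (-(n * t n ^ 2)) * Real.exp (-(n * t n ^ 2)) := Real.exp_add _ _
    _ ≤ Real.exp (-(n * t n ^ 2)) * (1 / 4) := by gcongr
    _ = _ := by ring

theorem QuadraticMGF.eventually_mass_le {a : ℕ → ℝ} {Ω : ℕ → Type*} [∀ n, Fintype (Ω n)]
    {w Z : ∀ n, Ω n → ℝ} {v : ℝ} (h : QuadraticMGF a w Z v) (hw : ∀ n x, 0 ≤ w n x) (hv : 0 < v)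
    (ha : Tendsto a atTop atTop) {x : ℝ} (hx : Real.sqrt (2 * v) < x) :
    ∀ᶠ n in atTop, mass (w n) {ω | a n * x ≤ Z n ω} ≤ Real.exp (-a n) / 4 := by
  obtain ⟨δ, hδ, h1⟩ := h.mass_le hw hv hx
  have h2 : Tendsto (fun n => Real.exp (-(a n * δ))) atTop (𝓝 0) :=
    Real.tendsto_exp_neg_atTop_nhds_zero.comp (ha.atTop_mul_const hδ)
  filter_upwards [h1, h2.eventually_le_const (show (0 : ℝ) < 1 / 4 by norm_num)] with n h3 h4
  calc _ ≤ Real.exp (-(a n * (1 + δ))) := h3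
    _ = Real.exp (-a n) * Real.exp (-(a n * δ)) := by rw [← Real.exp_add]; ring_nf
    _ ≤ Real.exp (-a n) * (1 / 4) := by gcongr
    _ = _ := by ring

theorem QuadraticMGF.eventually_le_mass {a : ℕ → ℝ} {Ω : ℕ → Type*} [∀ n, Fintype (Ω n)]
    {w Z : ∀ n, Ω n → ℝ} {v : ℝ} (h : QuadraticMGF a w Z v) (hw : ∀ n x, 0 ≤ w n x) (hv : 0 < v)
    (ha : Tendsto a atTop atTop) {x : ℝ} (hx0 : 0 ≤ x) (hx : x < Real.sqrt (2 * v)) :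
    ∀ᶠ n in atTop, Real.exp (-a n) * 4 ≤ mass (w n) {ω | a n * x ≤ Z n ω} := by
  obtain ⟨δ, hδ, h1⟩ := h.le_mass hw hv ha hx0 hx
  have h2 : Tendsto (fun n => Real.exp (a n * δ)) atTop atTop :=
    Real.tendsto_exp_atTop.comp (ha.atTop_mul_const hδ)
  filter_upwards [h1, h2.eventually_ge_atTop 4] with n h3 h4
  calc _ ≤ Real.exp (-a n) * Real.exp (a n * δ) := by gcongr
    _ = Real.exp (-(a n * (1 - δ))) := by rw [← Real.exp_add]; ring_nf
    _ ≤ _ := h3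

section Tails

variable {t : ℕ → ℝ} {m : ℕ → ℕ} {κ z : ℝ} {h : ℕ → ℝ}

theorem eventually_mass_lt_llr_le (hp : IsProbDist p) (hV : 0 < relV p (unif d))
    (ht : ModerateSeq t) (hκ : 0 < κ) (hm : Tendsto (fun n : ℕ => (m n : ℝ) / n) atTop (𝓝 κ))
    (hz : Real.sqrt (2 * (κ * relV p (unif d))) < z)
    (hh : ∀ᶠ n in atTop, m n * relD p (unif d) + n * t n * z ≤ h n) :
    ∀ᶠ n : ℕ in atTop, mass (tpow p (m n)) {f | h n < llr p (m n) f} ≤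
      Real.exp (-(n * t n ^ 2)) / 4 := by
  filter_upwards [(quadraticMGF_llr hp ht.1 hκ.le hm).eventually_mass_le
    (fun n => (hp.tpow _).1) (by positivity) ht.tendsto_mul_sq hz, hh, ht.eventually_pos]
    with n h1 h2 h3
  refine (mass_mono (hp.tpow _).1 fun f _ hf => ?_).trans h1
  have hf' : h n < llr p (m n) f := hf
  have : (n : ℝ) * t n ^ 2 * z = t n * (n * t n * z) := by ring
  rw [Set.mem_ofPred_eq, this]
  gcongr
  linarith

theorem eventually_mass_llr_lt_le (hp : IsProbDist p) (hV : 0 < relV p (unif d))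
    (ht : ModerateSeq t) (hκ : 0 < κ) (hm : Tendsto (fun n : ℕ => (m n : ℝ) / n) atTop (𝓝 κ))
    (hz : Real.sqrt (2 * (κ * relV p (unif d))) < z)
    (hh : ∀ᶠ n in atTop, h n ≤ m n * relD p (unif d) - n * t n * z) :
    ∀ᶠ n : ℕ in atTop, mass (tpow p (m n)) {f | llr p (m n) f < h n} ≤
      Real.exp (-(n * t n ^ 2)) / 4 := by
  filter_upwards [(quadraticMGF_llr hp ht.1 hκ.le hm).neg.eventually_mass_le
    (fun n => (hp.tpow _).1) (by positivity) ht.tendsto_mul_sq hz, hh, ht.eventually_pos]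
    with n h1 h2 h3
  refine (mass_mono (hp.tpow _).1 fun f _ hf => ?_).trans h1
  have hf' : llr p (m n) f < h n := hf
  have : (n : ℝ) * t n ^ 2 * z = t n * (n * t n * z) := by ring
  rw [Set.mem_ofPred_eq, this, ← mul_neg]
  gcongr
  linarith

theorem eventually_le_mass_le_llr (hp : IsProbDist p) (hV : 0 < relV p (unif d))
    (ht : ModerateSeq t) (hκ : 0 < κ) (hm : Tendsto (fun n : ℕ => (m n : ℝ) / n) atTop (𝓝 κ))
    (hz0 : 0 ≤ z) (hz : z < Real.sqrt (2 * (κ * relV p (unif d))))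
    (hh : ∀ᶠ n in atTop, h n ≤ m n * relD p (unif d) + n * t n * z) :
    ∀ᶠ n : ℕ in atTop, Real.exp (-(n * t n ^ 2)) * 4 ≤
      mass (tpow p (m n)) {f | h n ≤ llr p (m n) f} := by
  filter_upwards [(quadraticMGF_llr hp ht.1 hκ.le hm).eventually_le_mass
    (fun n => (hp.tpow _).1) (by positivity) ht.tendsto_mul_sq hz0 hz, hh, ht.eventually_pos]
    with n h1 h2 h3
  refine h1.trans (mass_mono (hp.tpow _).1 fun f _ hf => ?_)
  have this : (n : ℝ) * t n ^ 2 * z = t n * (n * t n * z) := by ring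
  rw [Set.mem_ofPred_eq, this] at hf
  have := le_of_mul_le_mul_left hf h3
  rw [Set.mem_ofPred_eq]
  linarith

theorem eventually_le_mass_llr_le (hp : IsProbDist p) (hV : 0 < relV p (unif d))
    (ht : ModerateSeq t) (hκ : 0 < κ) (hm : Tendsto (fun n : ℕ => (m n : ℝ) / n) atTop (𝓝 κ))
    (hz0 : 0 ≤ z) (hz : z < Real.sqrt (2 * (κ * relV p (unif d))))
    (hh : ∀ᶠ n in atTop, m n * relD p (unif d) - n * t n * z ≤ h n) :
    ∀ᶠ n : ℕ in atTop, Real.exp (-(n * t n ^ 2)) * 4 ≤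
      mass (tpow p (m n)) {f | llr p (m n) f ≤ h n} := by
  filter_upwards [(quadraticMGF_llr hp ht.1 hκ.le hm).neg.eventually_le_mass
    (fun n => (hp.tpow _).1) (by positivity) ht.tendsto_mul_sq hz0 hz, hh, ht.eventually_pos]
    with n h1 h2 h3
  refine h1.trans (mass_mono (hp.tpow _).1 fun f _ hf => ?_)
  have this : (n : ℝ) * t n ^ 2 * z = t n * (n * t n * z) := by ring
  rw [Set.mem_ofPred_eq, this, ← mul_neg] at hf
  have := le_of_mul_le_mul_left hf h3
  rw [Set.mem_ofPred_eq]
  linarith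

end Tails

theorem tendsto_natCast_div_self : Tendsto (fun n : ℕ => (n : ℝ) / n) atTop (𝓝 1) := by
  refine tendsto_const_nhds.congr' ?_
  filter_upwards [eventually_gt_atTop 0] with n hn
  rw [div_self (by positivity)]

end ModerateDeviations

/-! ### Conversion rates -/

section Rates

/-- The number of target copies at first-order rate `κ` and moderate correction `r`. -/
def targetCount (κ r : ℝ) (t : ℕ → ℝ) (n : ℕ) : ℕ := ⌊(n : ℝ) * (κ + r * t n)⌋₊

variable {t : ℕ → ℝ} {κ : ℝ}

theorem eventually_targetCount_le (ht : ModerateSeq t) (hκ : 0 < κ) (r : ℝ) :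
    ∀ᶠ n : ℕ in atTop, (targetCount κ r t n : ℝ) ≤ n * κ + n * t n * r := by
  have h : Tendsto (fun n => κ + r * t n) atTop (𝓝 κ) := by
    simpa using (ht.1.const_mul r).const_add κ
  filter_upwards [h.eventually_const_lt hκ] with n hn
  calc (targetCount κ r t n : ℝ) ≤ n * (κ + r * t n) := Nat.floor_le (by positivity)
    _ = _ := by ring

theorem eventually_le_targetCount (ht : ModerateSeq t) (κ r : ℝ) {η : ℝ} (hη : 0 < η) :
    ∀ᶠ n : ℕ in atTop, n * κ + n * t n * (r - η) ≤ (targetCount κ r t n : ℝ) := by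
  filter_upwards [(ht.tendsto_mul.atTop_mul_const hη).eventually_ge_atTop 1] with n hn
  have := Nat.lt_floor_add_one ((n : ℝ) * (κ + r * t n))
  unfold targetCount
  linarith

theorem tendsto_targetCount_div (ht : ModerateSeq t) (hκ : 0 < κ) (r : ℝ) :
    Tendsto (fun n : ℕ => (targetCount κ r t n : ℝ) / n) atTop (𝓝 κ) := by
  have h : ∀ c : ℝ, Tendsto (fun n => κ + t n * c) atTop (𝓝 κ) := fun c => by
    simpa using (ht.1.mul_const c).const_add κ
  refine tendsto_of_tendsto_of_tendsto_of_le_of_le' (h (r - 1)) (h r) ?_ ?_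
  · filter_upwards [eventually_le_targetCount ht κ r one_pos, eventually_gt_atTop 0] with n h1 hn
    rw [le_div_iff₀ (by positivity)]
    linarith
  · filter_upwards [eventually_targetCount_le ht hκ r, eventually_gt_atTop 0] with n h1 hn
    rw [div_le_iff₀ (by positivity)]
    linarith

variable {d : ℕ} {p q : Fin d → ℝ}

/-- The numbers of target copies attainable from `n` source copies with error `e`. -/
def attainable (p q : Fin d → ℝ) (n : ℕ) (e : ℝ) : Set ℕ :=
  {m : ℕ | ApproxMajTV (tensor (tpow p n) (tpow (unif d) m))
    (tensor (tpow q m) (tpow (unif d) n)) e}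

theorem eventually_mem_upperBounds_of_mass_lt (hd : 0 < d) (hp : IsProbDist p)
    (hq : IsProbDist q) {e : ℕ → ℝ} {r x y : ℝ}
    (h : ∀ᶠ n : ℕ in atTop,
      mass (tpow p n) {f | n * relD p (unif d) + n * t n * y < llr p n f} +
        Real.exp (-(n * t n * (x - y))) + e n <
      mass (tpow q (targetCount κ r t n))
        {f | n * relD p (unif d) + n * t n * x ≤ llr q (targetCount κ r t n) f}) :
    ∀ᶠ n in atTop, targetCount κ r t n ∈ upperBounds (attainable p q n (e n)) := by
  filter_upwards [h] with n hn m hm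
  by_contra! hlt
  have := ApproxMajTV.mass_le hd hp hq hm hlt.le (n * relD p (unif d) + n * t n * x)
    (n * relD p (unif d) + n * t n * y)
  have heq : n * relD p (unif d) + n * t n * y - (n * relD p (unif d) + n * t n * x) =
    -(n * t n * (x - y)) := by ring
  rw [heq] at this
  linarith

theorem mass_add_compl_lt {α : Type*} [Fintype α] {w : α → ℝ} (hw : ∑ x, w x = 1) (Y : α → ℝ)
    (c : ℝ) : mass w {f | Y f < c} + mass w {f | c ≤ Y f} = 1 := by
  rw [← hw, ← mass_add_mass_compl w {f | Y f < c}]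
  congr 2
  ext f
  simp

theorem eventually_upperBound_direct_left
    (hd : 0 < d) (hp : IsProbDist p) (hq : IsProbDist q)
    (hDp : 0 < relD p (unif d)) (hDq : 0 < relD q (unif d))
    (hVp : 0 < relV p (unif d)) (hVq : 0 < relV q (unif d))
    (ht : ModerateSeq t) (hκ : κ = relD p (unif d) / relD q (unif d))
    {η : ℝ} (hη : 0 < η)
    (hηB : η < Real.sqrt (2 * (κ * relV q (unif d)))) :
    ∀ᶠ n : ℕ in atTop, targetCount κ ((Real.sqrt (2 * (1 * relV p (unif d))) -
      Real.sqrt (2 * (κ * relV q (unif d))) + 3 * η) / relD q (unif d)) t n ∈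
      upperBounds (attainable p q n (Real.exp (-(n * t n ^ 2)))) := by
  have hκ0 : 0 < κ := by rw [hκ]; positivity
  set A := Real.sqrt (2 * (1 * relV p (unif d))) with hA
  set B := Real.sqrt (2 * (κ * relV q (unif d))) with hB
  set r := (A - B + 3 * η) / relD q (unif d) with hr
  apply eventually_mem_upperBounds_of_mass_lt hd hp hq (x := A + 2 * η) (y := A + η)
  filter_upwards [eventually_mass_lt_llr_le (z := A + η) (m := fun n => n)
      (h := fun n => n * relD p (unif d) + n * t n * (A + η)) hp hVp ht one_pos
      tendsto_natCast_div_self (by linarith) (Eventually.of_forall fun n => le_rfl),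
    eventually_le_mass_le_llr (z := B - η / 2) (m := targetCount κ r t)
      (h := fun n => n * relD p (unif d) + n * t n * (A + 2 * η)) hq hVq ht hκ0
      (tendsto_targetCount_div ht hκ0 r) (by linarith) (by linarith) (by
        filter_upwards [eventually_le_targetCount ht κ r
          (show 0 < η / 2 / relD q (unif d) by positivity)] with n hn
        have h1 := mul_le_mul_of_nonneg_right hn hDq.le
        have h2 : (n * κ + n * t n * (r - η / 2 / relD q (unif d))) * relD q (unif d) =
            n * relD p (unif d) + n * t n * (A - B + 3 * η - η / 2) := by
          rw [hr, hκ]; field_simp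
        linarith),
    ht.eventually_exp_neg_mul_le hη] with n h1 h2 h3
  have h4 : (n : ℝ) * t n * (A + 2 * η - (A + η)) = n * t n * η := by ring
  rw [h4]
  linarith [Real.exp_pos (-((n : ℝ) * t n ^ 2))]

theorem eventually_upperBound_direct_right
    (hd : 0 < d) (hp : IsProbDist p) (hq : IsProbDist q)
    (hDp : 0 < relD p (unif d)) (hDq : 0 < relD q (unif d))
    (hVp : 0 < relV p (unif d)) (hVq : 0 < relV q (unif d))
    (ht : ModerateSeq t) (hκ : κ = relD p (unif d) / relD q (unif d))
    {η : ℝ} (hη : 0 < η)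
    (hηA : η < Real.sqrt (2 * (1 * relV p (unif d)))) :
    ∀ᶠ n : ℕ in atTop, targetCount κ ((Real.sqrt (2 * (κ * relV q (unif d))) -
      Real.sqrt (2 * (1 * relV p (unif d))) + 3 * η) / relD q (unif d)) t n ∈
      upperBounds (attainable p q n (Real.exp (-(n * t n ^ 2)))) := by
  have hκ0 : 0 < κ := by rw [hκ]; positivity
  set A := Real.sqrt (2 * (1 * relV p (unif d))) with hA
  set B := Real.sqrt (2 * (κ * relV q (unif d))) with hB
  set r := (B - A + 3 * η) / relD q (unif d) with hr
  apply eventually_mem_upperBounds_of_mass_lt hd hp hq (x := -A + 2 * η) (y := -A + η)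
  filter_upwards [eventually_le_mass_llr_le (z := A - η) (m := fun n => n)
      (h := fun n => n * relD p (unif d) + n * t n * (-A + η)) hp hVp ht one_pos
      tendsto_natCast_div_self (by linarith) (by linarith)
      (Eventually.of_forall fun n => by linarith),
    eventually_mass_llr_lt_le (z := B + η / 2) (m := targetCount κ r t)
      (h := fun n => n * relD p (unif d) + n * t n * (-A + 2 * η)) hq hVq ht hκ0
      (tendsto_targetCount_div ht hκ0 r) (by linarith) (by
        filter_upwards [eventually_le_targetCount ht κ r
          (show 0 < η / 2 / relD q (unif d) by positivity)] with n hn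
        have h1 := mul_le_mul_of_nonneg_right hn hDq.le
        have h2 : (n * κ + n * t n * (r - η / 2 / relD q (unif d))) * relD q (unif d) =
            n * relD p (unif d) + n * t n * (B - A + 3 * η - η / 2) := by
          rw [hr, hκ]; field_simp
        linarith),
    ht.eventually_exp_neg_mul_le hη] with n h1 h2 h3
  have h4 : (n : ℝ) * t n * (-A + 2 * η - (-A + η)) = n * t n * η := by ring
  have h5 := mass_add_compl_lt (hq.tpow (targetCount κ r t n)).2
    (llr q (targetCount κ r t n)) (n * relD p (unif d) + n * t n * (-A + 2 * η))
  have h6 := mass_add_mass_compl (tpow p n)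
    {f | llr p n f ≤ n * relD p (unif d) + n * t n * (-A + η)}
  have h7 : {f | llr p n f ≤ n * relD p (unif d) + n * t n * (-A + η)}ᶜ =
      {f | n * relD p (unif d) + n * t n * (-A + η) < llr p n f} := by
    ext f
    simp
  rw [(hp.tpow n).2, h7] at h6
  rw [h4]
  linarith [Real.exp_pos (-((n : ℝ) * t n ^ 2))]

theorem eventually_upperBound_converse
    (hd : 0 < d) (hp : IsProbDist p) (hq : IsProbDist q)
    (hDp : 0 < relD p (unif d)) (hDq : 0 < relD q (unif d))
    (hVp : 0 < relV p (unif d)) (hVq : 0 < relV q (unif d))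
    (ht : ModerateSeq t) (hκ : κ = relD p (unif d) / relD q (unif d))
    {η : ℝ} (hη : 0 < η) :
    ∀ᶠ n : ℕ in atTop, targetCount κ ((Real.sqrt (2 * (1 * relV p (unif d))) +
      Real.sqrt (2 * (κ * relV q (unif d))) + 3 * η) / relD q (unif d)) t n ∈
      upperBounds (attainable p q n (1 - Real.exp (-(n * t n ^ 2)))) := by
  have hκ0 : 0 < κ := by rw [hκ]; positivity
  set A := Real.sqrt (2 * (1 * relV p (unif d))) with hA
  set B := Real.sqrt (2 * (κ * relV q (unif d))) with hB
  set r := (A + B + 3 * η) / relD q (unif d) with hr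
  apply eventually_mem_upperBounds_of_mass_lt hd hp hq (x := A + 2 * η) (y := A + η)
  filter_upwards [eventually_mass_lt_llr_le (z := A + η) (m := fun n => n)
      (h := fun n => n * relD p (unif d) + n * t n * (A + η)) hp hVp ht one_pos
      tendsto_natCast_div_self (by linarith) (Eventually.of_forall fun n => le_rfl),
    eventually_mass_llr_lt_le (z := B + η / 2) (m := targetCount κ r t)
      (h := fun n => n * relD p (unif d) + n * t n * (A + 2 * η)) hq hVq ht hκ0
      (tendsto_targetCount_div ht hκ0 r) (by linarith) (by
        filter_upwards [eventually_le_targetCount ht κ r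
          (show 0 < η / 2 / relD q (unif d) by positivity)] with n hn
        have h1 := mul_le_mul_of_nonneg_right hn hDq.le
        have h2 : (n * κ + n * t n * (r - η / 2 / relD q (unif d))) * relD q (unif d) =
            n * relD p (unif d) + n * t n * (A + B + 3 * η - η / 2) := by
          rw [hr, hκ]; field_simp
        linarith),
    ht.eventually_exp_neg_mul_le hη] with n h1 h2 h3
  have h4 : (n : ℝ) * t n * (A + 2 * η - (A + η)) = n * t n * η := by ring
  have h5 := mass_add_compl_lt (hq.tpow (targetCount κ r t n)).2
    (llr q (targetCount κ r t n)) (n * relD p (unif d) + n * t n * (A + 2 * η))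
  rw [h4]
  linarith [Real.exp_pos (-((n : ℝ) * t n ^ 2))]

theorem exists_eventually_targetCount_mem
    (hd : 0 < d) (hp : IsProbDist p) (hq : IsProbDist q)
    (hDp : 0 < relD p (unif d)) (hDq : 0 < relD q (unif d))
    (hVp : 0 < relV p (unif d)) (hVq : 0 < relV q (unif d))
    (ht : ModerateSeq t) (hκ : κ = relD p (unif d) / relD q (unif d)) :
    ∃ r : ℝ, ∀ᶠ n : ℕ in atTop,
      targetCount κ r t n ∈ attainable p q n (Real.exp (-(n * t n ^ 2))) := by
  have hκ0 : 0 < κ := by rw [hκ]; positivity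
  set A := Real.sqrt (2 * (1 * relV p (unif d))) with hA
  set B := Real.sqrt (2 * (κ * relV q (unif d))) with hB
  set r := -(A + B + 3) / relD q (unif d) with hr
  refine ⟨r, ?_⟩
  have hpos : Tendsto (fun n : ℕ => (n : ℝ) * (relD p (unif d) - t n * (A + 1))) atTop atTop := by
    refine tendsto_natCast_atTop_atTop.atTop_mul_pos hDp ?_
    simpa using (ht.1.mul_const (A + 1)).const_sub (relD p (unif d))
  filter_upwards [eventually_mass_llr_lt_le (z := A + 1) (m := fun n => n)
      (h := fun n => n * relD p (unif d) - n * t n * (A + 1)) hp hVp ht one_pos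
      tendsto_natCast_div_self (by linarith) (Eventually.of_forall fun n => le_rfl),
    eventually_mass_lt_llr_le (z := B + 1) (m := targetCount κ r t)
      (h := fun n => n * relD p (unif d) - n * t n * (A + 1) - 1) hq hVq ht hκ0
      (tendsto_targetCount_div ht hκ0 r) (by linarith) (by
        filter_upwards [eventually_targetCount_le ht hκ0 r,
          ht.tendsto_mul.eventually_ge_atTop 1] with n hn hn1
        have h1 := mul_le_mul_of_nonneg_right hn hDq.le
        have h2 : (n * κ + n * t n * r) * relD q (unif d) =
            n * relD p (unif d) - n * t n * (A + B + 3) := by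
          rw [hr, hκ]; field_simp; ring
        linarith),
    hpos.eventually_ge_atTop 1] with n h1 h2 h3
  have he := Real.exp_pos (-((n : ℝ) * t n ^ 2))
  refine approxMajTV_of_llr hd hp hq (x := n * relD p (unif d) - n * t n * (A + 1) - 1)
    (y := n * relD p (unif d) - n * t n * (A + 1)) (by linarith) (by linarith) he.le ?_ h1
    (h2.trans (by linarith))
  rw [Real.exp_le_one_iff]
  have : (0 : ℝ) ≤ n * t n ^ 2 := by positivity
  linarith

end Rates

theorem ModerateSeq.eventually_rate_le {t : ℕ → ℝ} (ht : ModerateSeq t) {κ r : ℝ} (hκ : 0 < κ)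
    {S : ℕ → Set ℕ} (h : ∀ᶠ n in atTop, targetCount κ r t n ∈ upperBounds (S n)) :
    ∀ᶠ n : ℕ in atTop, ((sSup (S n) : ℕ) / (n : ℝ) - κ) / t n ≤ r := by
  filter_upwards [h, ht.eventually_pos, eventually_targetCount_le ht hκ r,
    eventually_gt_atTop 0] with n h1 h2 h3 hn
  have h4 : ((sSup (S n) : ℕ) : ℝ) ≤ targetCount κ r t n := by exact_mod_cast csSup_le' h1
  have hn' : (0 : ℝ) < n := by exact_mod_cast hn
  have h5 : ((sSup (S n) : ℕ) : ℝ) / n ≤ κ + t n * r := by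
    rw [div_le_iff₀ hn']
    linarith
  rw [div_le_iff₀ h2]
  linarith

theorem ModerateSeq.eventually_le_rate {t : ℕ → ℝ} (ht : ModerateSeq t) {κ r : ℝ}
    {S : ℕ → Set ℕ} (hS : ∀ᶠ n in atTop, BddAbove (S n))
    (h : ∀ᶠ n in atTop, targetCount κ r t n ∈ S n) :
    ∀ᶠ n : ℕ in atTop, r - 1 ≤ ((sSup (S n) : ℕ) / (n : ℝ) - κ) / t n := by
  filter_upwards [h, hS, ht.eventually_pos, eventually_le_targetCount ht κ r one_pos,
    eventually_gt_atTop 0] with n h1 hb h2 h3 hn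
  have h4 : (targetCount κ r t n : ℝ) ≤ (sSup (S n) : ℕ) := by exact_mod_cast le_csSup hb h1
  have hn' : (0 : ℝ) < n := by exact_mod_cast hn
  have h5 : κ + t n * (r - 1) ≤ ((sSup (S n) : ℕ) : ℝ) / n := by
    rw [le_div_iff₀ hn']
    linarith
  rw [le_div_iff₀ h2]
  linarith

theorem limsup_le_of_forall_small {f : ℕ → ℝ} {C c K η₀ : ℝ} (hc : 0 < c) (hη₀ : 0 < η₀)
    (hK : ∀ᶠ n in atTop, K ≤ f n)
    (h : ∀ η, 0 < η → η < η₀ → ∀ᶠ n in atTop, f n ≤ C + c * η) : limsup f atTop ≤ C := by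
  refine le_of_forall_pos_le_add fun ε hε => ?_
  have hcob : IsCoboundedUnder (· ≤ ·) atTop f :=
    IsBoundedUnder.isCoboundedUnder_le ⟨K, by simpa using hK⟩
  have hη : 0 < min (ε / c) (η₀ / 2) := by positivity
  refine limsup_le_of_le hcob ?_
  filter_upwards [h _ hη ((min_le_right _ _).trans_lt (by linarith))] with n hn
  refine hn.trans ?_
  have : c * min (ε / c) (η₀ / 2) ≤ c * (ε / c) := by gcongr; exact min_le_left _ _
  rw [mul_div_cancel₀ _ hc.ne'] at this
  linarith

/-- Optimality: upper bounds on the optimal thermodynamic-direction conversion rate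
at infinite temperature, in both the direct and converse regimes. -/
theorem thermo_uniform_optimality
    {d : ℕ} (hd : 2 ≤ d) (p q : Fin d → ℝ) (hp : IsProbDist p) (hq : IsProbDist q)
    (hDp : 0 < relD p (unif d)) (hDq : 0 < relD q (unif d))
    (hVp : 0 < relV p (unif d)) (hVq : 0 < relV q (unif d))
    (t : ℕ → ℝ) (ht : ModerateSeq t)
    (R : ℕ → ℝ → ℝ)
    (hR : ∀ n : ℕ, ∀ e : ℝ, 0 ≤ e → R n e =
      (↑(sSup {m : ℕ | ApproxMajTV (tensor (tpow p n) (tpow (unif d) m))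
          (tensor (tpow q m) (tpow (unif d) n)) e}) : ℝ) / (n : ℝ))
    (ν : ℝ)
    (hν : ν = (relV p (unif d) / relD p (unif d)) / (relV q (unif d) / relD q (unif d))) :
    (Filter.limsup (fun n : ℕ =>
        (R n (Real.exp (-((n : ℝ) * t n ^ 2))) - relD p (unif d) / relD q (unif d)) / t n)
        atTop ≤
      -(Real.sqrt (2 * relV p (unif d)) / relD q (unif d)) * |1 - 1 / Real.sqrt ν|) ∧
    (Filter.limsup (fun n : ℕ =>
        (R n (1 - Real.exp (-((n : ℝ) * t n ^ 2))) - relD p (unif d) / relD q (unif d)) / t n)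
        atTop ≤
      Real.sqrt (2 * relV p (unif d)) / relD q (unif d) * |1 + 1 / Real.sqrt ν|) := by
  have hd0 : 0 < d := by omega
  obtain ⟨κ, hκ⟩ : ∃ κ, κ = relD p (unif d) / relD q (unif d) := ⟨_, rfl⟩
  have hκ0 : 0 < κ := by rw [hκ]; positivity
  rw [← hκ]
  have hRm : ∀ n : ℕ, R n (Real.exp (-((n : ℝ) * t n ^ 2))) =
      (sSup (attainable p q n (Real.exp (-((n : ℝ) * t n ^ 2)))) : ℕ) / (n : ℝ) :=
    fun n => hR n _ (Real.exp_pos _).le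
  have hRp : ∀ n : ℕ, R n (1 - Real.exp (-((n : ℝ) * t n ^ 2))) =
      (sSup (attainable p q n (1 - Real.exp (-((n : ℝ) * t n ^ 2)))) : ℕ) / (n : ℝ) := by
    refine fun n => hR n _ ?_
    rw [sub_nonneg, Real.exp_le_one_iff, neg_nonpos]
    positivity
  simp only [hRm, hRp]
  obtain ⟨A, hA⟩ : ∃ A, A = Real.sqrt (2 * (1 * relV p (unif d))) := ⟨_, rfl⟩
  obtain ⟨B, hB⟩ : ∃ B, B = Real.sqrt (2 * (κ * relV q (unif d))) := ⟨_, rfl⟩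
  have hA0 : 0 < A := by rw [hA]; positivity
  have hB0 : 0 < B := by rw [hB]; positivity
  have hA' : Real.sqrt (2 * relV p (unif d)) = A := by rw [hA, one_mul]
  have hν' : Real.sqrt ν = A / B := by
    rw [hA, hB, ← Real.sqrt_div (by positivity), hν, hκ]
    congr 1
    field_simp
  have hc : 0 < 3 / relD q (unif d) := by positivity
  have hdirect := fun η hη hηB => eventually_upperBound_direct_left hd0 hp hq hDp hDq hVp hVq ht hκ
    (η := η) hη hηB
  have hdirect' := fun η hη hηA => eventually_upperBound_direct_right hd0 hp hq hDp hDq hVp hVq ht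
    hκ (η := η) hη hηA
  have hconverse := fun η hη => eventually_upperBound_converse hd0 hp hq hDp hDq hVp hVq ht hκ
    (η := η) hη
  obtain ⟨r, hr⟩ := exists_eventually_targetCount_mem hd0 hp hq hDp hDq hVp hVq ht hκ
  rw [← hA, ← hB] at hdirect hdirect' hconverse
  rw [hA', hν']
  have habs : A * |1 - 1 / (A / B)| = |A - B| := by
    nth_rewrite 1 [← abs_of_pos hA0]
    rw [← abs_mul]
    congr 1
    field_simp
  have habs' : A * |1 + 1 / (A / B)| = A + B := by
    rw [abs_of_pos (by positivity)]
    field_simp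
  constructor
  · have hC : -(A / relD q (unif d)) * |1 - 1 / (A / B)| = -|A - B| / relD q (unif d) := by
      rw [← habs]; ring
    rw [hC]
    have hbdd : ∀ᶠ n : ℕ in atTop,
        BddAbove (attainable p q n (Real.exp (-((n : ℝ) * t n ^ 2)))) := by
      filter_upwards [hdirect (B / 2) (by linarith) (by linarith)] with n hn
      exact ⟨_, hn⟩
    refine limsup_le_of_forall_small hc (lt_min hA0 hB0) (ht.eventually_le_rate hbdd hr)
      fun η hη hη' => ?_
    rcases le_total A B with hAB | hAB
    · convert ht.eventually_rate_le hκ0 (hdirect η hη (hη'.trans_le (min_le_right _ _))) using 3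
      rw [abs_of_nonpos (by linarith)]
      ring
    · convert ht.eventually_rate_le hκ0 (hdirect' η hη (hη'.trans_le (min_le_left _ _))) using 3
      rw [abs_of_nonneg (by linarith)]
      ring
  · have hC : A / relD q (unif d) * |1 + 1 / (A / B)| = (A + B) / relD q (unif d) := by
      rw [← habs']; ring
    rw [hC]
    have hbdd : ∀ᶠ n : ℕ in atTop,
        BddAbove (attainable p q n (1 - Real.exp (-((n : ℝ) * t n ^ 2)))) := by
      filter_upwards [hconverse 1 one_pos] with n hn
      exact ⟨_, hn⟩
    have hsmall : Tendsto (fun n : ℕ => Real.exp (-((n : ℝ) * t n ^ 2))) atTop (𝓝 0) :=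
      Real.tendsto_exp_neg_atTop_nhds_zero.comp ht.tendsto_mul_sq
    have hr' : ∀ᶠ n : ℕ in atTop,
        targetCount κ r t n ∈ attainable p q n (1 - Real.exp (-((n : ℝ) * t n ^ 2))) := by
      filter_upwards [hr, hsmall.eventually_le_const (show (0 : ℝ) < 1 / 2 by norm_num)]
        with n ⟨b, hb, hmaj, htv⟩ hn2
      exact ⟨b, hb, hmaj, htv.trans (by linarith)⟩
    refine limsup_le_of_forall_small hc one_pos (ht.eventually_le_rate hbdd hr')
      fun η hη _ => ?_
    convert ht.eventually_rate_le hκ0 (hconverse η hη) using 3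
    ring
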